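/- Let G be a 3-edge-connected cubic graph and A a vertex subset with ∅ ≠ A ⊊ V(G) and |δ(A)| = 3. Let M₁ be a set of edges each having at least one endpoint in V(G)∖A, covering every vertex of V(G)∖A exactly once, with |M₁ ∩ δ(A)| = 1, and such that |M₁ ∩ δ(B)| = 1 for every B ⊆ V(G)∖A with ∅ ≠ B and |δ(B)| = 3. Let M₂ be a set of edges each having at least one endpoint in A, covering every vertex of A exactly once, with |M₂ ∩ δ(A)| = 1, and such that |M₂ ∩ δ(B)| = 1 for every B ⊆ A with ∅ ≠ B and |δ(B)| = 3. If M₁ ∩ δ(A) = M₂ ∩ δ(A), then M₁ ∪ M₂ is a perfect matching of G that contains exactly one edge of every 3-edge-cut of G. -/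

import Mathlib

open SimpleGraph Set

/-- The edge cut `δ(A)`: edges of `G` with exactly one endpoint in `A`. -/
def edgeCut {V : Type*} (G : SimpleGraph V) (A : Set V) : Set (Sym2 V) :=
  {e | e ∈ G.edgeSet ∧ ∃ u v, e = s(u, v) ∧ u ∈ A ∧ v ∉ A}

/-- A graph is cubic if every vertex has exactly three neighbours. -/
def IsCubic {V : Type*} (G : SimpleGraph V) : Prop :=
  ∀ v : V, (G.neighborSet v).ncard = 3

/-- A graph is bridgeless if it has no bridge. -/
def Bridgeless {V : Type*} (G : SimpleGraph V) : Prop :=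
  ∀ e : Sym2 V, ¬ G.IsBridge e

/-- A connected graph is 3-edge-connected if it stays connected after
removing fewer than three edges. -/
def ThreeEdgeConnected {V : Type*} (G : SimpleGraph V) : Prop :=
  G.Connected ∧ ∀ S : Set (Sym2 V), S.ncard < 3 → (G.deleteEdges S).Connected

/-- A perfect matching viewed as a set of edges: pairwise disjoint edges of `G`
covering every vertex exactly once. -/
def IsPerfectMatchingSet {V : Type*} (G : SimpleGraph V) (M : Set (Sym2 V)) : Prop :=
  M ⊆ G.edgeSet ∧ ∀ v : V, ∃! e, e ∈ M ∧ v ∈ e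

theorem edgeCut_compl {V : Type*} (G : SimpleGraph V) (A : Set V) :
    edgeCut G Aᶜ = edgeCut G A := by
  ext e
  constructor
  · rintro ⟨he, u, v, rfl, hu, hv⟩
    exact ⟨he, v, u, Sym2.eq_swap, not_not.mp hv, hu⟩
  · rintro ⟨he, u, v, rfl, hu, hv⟩
    exact ⟨he, v, u, Sym2.eq_swap, hv, not_not.mpr hu⟩

/-- An edge with an endpoint in `A` and an endpoint outside `A` lies in the cut `δ(A)`. -/
theorem mem_edgeCut_of_mem {V : Type*} {G : SimpleGraph V} {A : Set V} {e : Sym2 V}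
    (he : e ∈ G.edgeSet) {u v : V} (hu : u ∈ A) (hv : v ∉ A) (hue : u ∈ e) (hve : v ∈ e) :
    e ∈ edgeCut G A :=
  ⟨he, u, v, (Sym2.mem_and_mem_iff (by rintro rfl; exact hv hu)).mp ⟨hue, hve⟩, hu, hv⟩

/-- Every cut of a 3-edge-connected graph has at least three edges. -/
theorem ThreeEdgeConnected.three_le_ncard_edgeCut {V : Type*} {G : SimpleGraph V}
    (h : ThreeEdgeConnected G) {X : Set V} (hX : X.Nonempty) (hX' : Xᶜ.Nonempty) :
    3 ≤ (edgeCut G X).ncard := by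
  by_contra! hlt
  obtain ⟨u, hu⟩ := hX
  obtain ⟨v, hv⟩ := hX'
  obtain ⟨p⟩ := (h.2 _ hlt).preconnected u v
  obtain ⟨d, -, hd, hd'⟩ := p.exists_boundary_dart X hu hv
  have hadj := d.adj
  rw [deleteEdges_adj] at hadj
  exact hadj.2 ⟨hadj.1, _, _, rfl, hd, hd'⟩

/-- The edges of `G` with one endpoint in `X` and the other in `Y`. -/
def edgesBetween {V : Type*} (G : SimpleGraph V) (X Y : Set V) : Set (Sym2 V) :=
  {e | e ∈ G.edgeSet ∧ ∃ u v, e = s(u, v) ∧ u ∈ X ∧ v ∈ Y}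

theorem edgesBetween_comm {V : Type*} (G : SimpleGraph V) (X Y : Set V) :
    edgesBetween G X Y = edgesBetween G Y X := by
  ext e
  constructor <;>
  · rintro ⟨he, u, v, rfl, hu, hv⟩
    exact ⟨he, v, u, Sym2.eq_swap, hv, hu⟩

theorem edgeCut_eq_edgesBetween_compl {V : Type*} (G : SimpleGraph V) (A : Set V) :
    edgeCut G A = edgesBetween G A Aᶜ := rfl

theorem ncard_edgesBetween_union_right {V : Type*} [Finite V] (G : SimpleGraph V)
    {X Y Z : Set V} (hYZ : Disjoint Y Z) (hXY : Disjoint X Y) :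
    (edgesBetween G X (Y ∪ Z)).ncard =
      (edgesBetween G X Y).ncard + (edgesBetween G X Z).ncard := by
  rw [← Set.ncard_union_eq _ (Set.toFinite _) (Set.toFinite _)]
  · congr 1
    ext e
    constructor
    · rintro ⟨he, u, v, rfl, hu, hv | hv⟩
      · exact Or.inl ⟨he, u, v, rfl, hu, hv⟩
      · exact Or.inr ⟨he, u, v, rfl, hu, hv⟩
    · rintro (⟨he, u, v, rfl, hu, hv⟩ | ⟨he, u, v, rfl, hu, hv⟩)
      · exact ⟨he, u, v, rfl, hu, Or.inl hv⟩
      · exact ⟨he, u, v, rfl, hu, Or.inr hv⟩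
  · rw [Set.disjoint_left]
    rintro _ ⟨-, u, v, rfl, hu, hv⟩ ⟨-, u', v', heq, hu', hv'⟩
    rcases Sym2.eq_iff.mp heq with ⟨rfl, rfl⟩ | ⟨rfl, rfl⟩
    · exact Set.disjoint_left.mp hYZ hv hv'
    · exact Set.disjoint_left.mp hXY hu' hv

theorem ncard_edgesBetween_union_left {V : Type*} [Finite V] (G : SimpleGraph V)
    {X Y Z : Set V} (hYZ : Disjoint Y Z) (hXY : Disjoint X Y) :
    (edgesBetween G (Y ∪ Z) X).ncard =
      (edgesBetween G Y X).ncard + (edgesBetween G Z X).ncard := by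
  rw [edgesBetween_comm, ncard_edgesBetween_union_right G hYZ hXY, edgesBetween_comm G X Y,
    edgesBetween_comm G X Z]

/-- In a 3-edge-connected graph, two 3-edge-cuts never cross. -/
theorem ThreeEdgeConnected.not_crossing {V : Type*} [Finite V] {G : SimpleGraph V}
    (h : ThreeEdgeConnected G) {A B : Set V}
    (hA : (edgeCut G A).ncard = 3) (hB : (edgeCut G B).ncard = 3) :
    B ⊆ A ∨ B ⊆ Aᶜ ∨ Bᶜ ⊆ A ∨ Bᶜ ⊆ Aᶜ := by
  by_contra! hcross
  obtain ⟨h₁, h₂, h₃, h₄⟩ := hcross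
  obtain ⟨x, hxB, hxA⟩ := Set.not_subset.mp h₁
  obtain ⟨y, hyB, hyA⟩ := Set.not_subset.mp h₂
  obtain ⟨z, hzB, hzA⟩ := Set.not_subset.mp h₃
  obtain ⟨w, hwB, hwA⟩ := Set.not_subset.mp h₄
  rw [Set.mem_compl_iff, not_not] at hyA hwA
  obtain ⟨P, hP⟩ : ∃ P, P = A ∩ B := ⟨_, rfl⟩
  obtain ⟨Q, hQ⟩ : ∃ Q, Q = A ∩ Bᶜ := ⟨_, rfl⟩
  obtain ⟨R, hR⟩ : ∃ R, R = Aᶜ ∩ B := ⟨_, rfl⟩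
  obtain ⟨S, hS⟩ : ∃ S, S = Aᶜ ∩ Bᶜ := ⟨_, rfl⟩
  have dPQ : Disjoint P Q := by rw [Set.disjoint_left]; grind
  have dPR : Disjoint P R := by rw [Set.disjoint_left]; grind
  have dPS : Disjoint P S := by rw [Set.disjoint_left]; grind
  have dQR : Disjoint Q R := by rw [Set.disjoint_left]; grind
  have dQS : Disjoint Q S := by rw [Set.disjoint_left]; grind
  have dRS : Disjoint R S := by rw [Set.disjoint_left]; grind
  have eA : A = P ∪ Q := by ext; grind
  have eA' : Aᶜ = R ∪ S := by ext; grind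
  have eB : B = P ∪ R := by ext; grind
  have eB' : Bᶜ = Q ∪ S := by ext; grind
  have cP : Pᶜ = Q ∪ (R ∪ S) := by ext; grind
  have cQ : Qᶜ = P ∪ (R ∪ S) := by ext; grind
  have cR : Rᶜ = P ∪ (Q ∪ S) := by ext; grind
  have cS : Sᶜ = P ∪ (Q ∪ R) := by ext; grind
  have hP3 := h.three_le_ncard_edgeCut (X := P) ⟨y, by grind⟩ ⟨x, by grind⟩
  have hQ3 := h.three_le_ncard_edgeCut (X := Q) ⟨w, by grind⟩ ⟨x, by grind⟩
  have hR3 := h.three_le_ncard_edgeCut (X := R) ⟨x, by grind⟩ ⟨y, by grind⟩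
  have hS3 := h.three_le_ncard_edgeCut (X := S) ⟨z, by grind⟩ ⟨x, by grind⟩
  rw [edgeCut_eq_edgesBetween_compl, eA', eA,
    ncard_edgesBetween_union_left G dPQ (by simp [dPR.symm, dPS.symm]),
    ncard_edgesBetween_union_right G dRS dPR, ncard_edgesBetween_union_right G dRS dQR] at hA
  rw [edgeCut_eq_edgesBetween_compl, eB', eB,
    ncard_edgesBetween_union_left G dPR (by simp [dPQ.symm, dPS.symm]),
    ncard_edgesBetween_union_right G dQS dPQ, ncard_edgesBetween_union_right G dQS dQR.symm,
    edgesBetween_comm G R Q] at hB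
  rw [edgeCut_eq_edgesBetween_compl, cP,
    ncard_edgesBetween_union_right G (by simp [dQR, dQS]) dPQ,
    ncard_edgesBetween_union_right G dRS dPR] at hP3
  rw [edgeCut_eq_edgesBetween_compl, cQ,
    ncard_edgesBetween_union_right G (by simp [dPR, dPS]) dPQ.symm,
    ncard_edgesBetween_union_right G dRS dQR, edgesBetween_comm G Q P] at hQ3
  rw [edgeCut_eq_edgesBetween_compl, cR,
    ncard_edgesBetween_union_right G (by simp [dPQ, dPS]) dPR.symm,
    ncard_edgesBetween_union_right G dQS dQR.symm, edgesBetween_comm G R P,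
    edgesBetween_comm G R Q] at hR3
  rw [edgeCut_eq_edgesBetween_compl, cS,
    ncard_edgesBetween_union_right G (by simp [dPQ, dPR]) dPS.symm,
    ncard_edgesBetween_union_right G dQR dQS.symm, edgesBetween_comm G S P,
    edgesBetween_comm G S Q, edgesBetween_comm G S R] at hS3
  omega

theorem stmt_5 {V : Type*} [Fintype V] (G : SimpleGraph V)
    (h3ec : ThreeEdgeConnected G) (hcubic : IsCubic G)
    (A : Set V) (hA : A.Nonempty) (hA' : A ≠ Set.univ)
    (hAcut : (edgeCut G A).ncard = 3)
    (M₁ M₂ : Set (Sym2 V)) (hM₁G : M₁ ⊆ G.edgeSet) (hM₂G : M₂ ⊆ G.edgeSet)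
    (hM₁end : ∀ e ∈ M₁, ∃ v ∈ Aᶜ, v ∈ e)
    (hM₁cov : ∀ v ∈ Aᶜ, ∃! e, e ∈ M₁ ∧ v ∈ e)
    (hM₁A : (M₁ ∩ edgeCut G A).ncard = 1)
    (hM₁cuts : ∀ B : Set V, B ⊆ Aᶜ → B.Nonempty → (edgeCut G B).ncard = 3 →
        (M₁ ∩ edgeCut G B).ncard = 1)
    (hM₂end : ∀ e ∈ M₂, ∃ v ∈ A, v ∈ e)
    (hM₂cov : ∀ v ∈ A, ∃! e, e ∈ M₂ ∧ v ∈ e)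
    (hM₂A : (M₂ ∩ edgeCut G A).ncard = 1)
    (hM₂cuts : ∀ B : Set V, B ⊆ A → B.Nonempty → (edgeCut G B).ncard = 3 →
        (M₂ ∩ edgeCut G B).ncard = 1)
    (hagree : M₁ ∩ edgeCut G A = M₂ ∩ edgeCut G A) :
    IsPerfectMatchingSet G (M₁ ∪ M₂) ∧
      ∀ B : Set V, B.Nonempty → B ≠ Set.univ → (edgeCut G B).ncard = 3 →
        ((M₁ ∪ M₂) ∩ edgeCut G B).ncard = 1 := by
  have mem₁ : ∀ e ∈ M₁ ∪ M₂, ∀ v ∈ Aᶜ, v ∈ e → e ∈ M₁ := by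
    rintro e (he | he) v hv hve
    · exact he
    · obtain ⟨u, hu, hue⟩ := hM₂end e he
      exact (hagree.ge ⟨he, mem_edgeCut_of_mem (hM₂G he) hu hv hue hve⟩).1
  have mem₂ : ∀ e ∈ M₁ ∪ M₂, ∀ v ∈ A, v ∈ e → e ∈ M₂ := by
    rintro e (he | he) v hv hve
    · obtain ⟨u, hu, hue⟩ := hM₁end e he
      exact (hagree.le ⟨he, mem_edgeCut_of_mem (hM₁G he) hv hu hve hue⟩).1
    · exact he
  have cut₁ : ∀ B ⊆ Aᶜ, (M₁ ∪ M₂) ∩ edgeCut G B = M₁ ∩ edgeCut G B := by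
    intro B hB
    refine Set.Subset.antisymm ?_ (Set.inter_subset_inter_left _ Set.subset_union_left)
    rintro _ ⟨he, hcut⟩
    obtain ⟨-, u, v, rfl, hu, -⟩ := id hcut
    exact ⟨mem₁ _ he u (hB hu) (Sym2.mem_mk_left u v), hcut⟩
  have cut₂ : ∀ B ⊆ A, (M₁ ∪ M₂) ∩ edgeCut G B = M₂ ∩ edgeCut G B := by
    intro B hB
    refine Set.Subset.antisymm ?_ (Set.inter_subset_inter_left _ Set.subset_union_right)
    rintro _ ⟨he, hcut⟩
    obtain ⟨-, u, v, rfl, hu, -⟩ := id hcut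
    exact ⟨mem₂ _ he u (hB hu) (Sym2.mem_mk_left u v), hcut⟩
  refine ⟨⟨Set.union_subset hM₁G hM₂G, fun v => ?_⟩, fun B hB hB' hBcut => ?_⟩
  · by_cases hv : v ∈ A
    · obtain ⟨e, ⟨he, hve⟩, huniq⟩ := hM₂cov v hv
      exact ⟨e, ⟨Or.inr he, hve⟩, fun f hf => huniq f ⟨mem₂ f hf.1 v hv hf.2, hf.2⟩⟩
    · obtain ⟨e, ⟨he, hve⟩, huniq⟩ := hM₁cov v hv
      exact ⟨e, ⟨Or.inl he, hve⟩, fun f hf => huniq f ⟨mem₁ f hf.1 v hv hf.2, hf.2⟩⟩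
  · rcases h3ec.not_crossing hAcut hBcut with h | h | h | h
    · rw [cut₂ B h, hM₂cuts B h hB hBcut]
    · rw [cut₁ B h, hM₁cuts B h hB hBcut]
    all_goals
      have hne : Bᶜ.Nonempty := Set.nonempty_compl.mpr hB'
      rw [← edgeCut_compl] at hBcut ⊢
    · rw [cut₂ Bᶜ h, hM₂cuts Bᶜ h hne hBcut]
    · rw [cut₁ Bᶜ h, hM₁cuts Bᶜ h hne hBcut]
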